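/- Let ω > 0, σ⋆ ≥ 0, and let σ₁, σ₂, σ₃ ∈ {0, σ⋆}. Define the complex numbers d_j := 1 + i σ_j/ω for j = 1, 2, 3. Then for every permutation (j, k, l) of (1, 2, 3) one has Re(d_k d_l / d_j) ≥ 1 − σ⋆²/ω². -/

import Mathlib

theorem re_one_add_I_mul_mul_div (a b c : ℝ) :
    ((1 + Complex.I * (b : ℂ)) * (1 + Complex.I * (c : ℂ)) / (1 + Complex.I * (a : ℂ))).re
      = (1 - b * c + a * (b + c)) / (1 + a ^ 2) := by
  have h : (1 : ℝ) + a ^ 2 ≠ 0 := by positivity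
  have h' : (1 : ℝ) + a * a ≠ 0 := by rwa [← sq]
  simp [Complex.div_re, Complex.normSq_apply]
  field_simp
  ring

/-- For the Cartesian PML stretching factors `d_j = 1 + i σ_j/ω`,
with `σ_j ∈ {0, σ⋆}`, every ratio `d_k d_l / d_j` (for a permutation `(j,k,l)` of the
three indices) has real part at least `1 - σ⋆²/ω²`. -/
theorem pml_stretching_real_part_lower_bound
    (ω σs : ℝ) (hω : 0 < ω) (hσs : 0 ≤ σs)
    (σ : Fin 3 → ℝ) (hσ : ∀ j, σ j = 0 ∨ σ j = σs)
    (d : Fin 3 → ℂ) (hd : ∀ j, d j = 1 + Complex.I * ((σ j / ω : ℝ) : ℂ))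
    (j k l : Fin 3) (hjk : j ≠ k) (hjl : j ≠ l) (hkl : k ≠ l) :
    1 - σs ^ 2 / ω ^ 2 ≤ (d k * d l / d j).re := by
  rw [hd j, hd k, hd l, re_one_add_I_mul_mul_div, ← div_pow, le_div_iff₀ (by positivity)]
  rcases hσ j with hj | hj <;> rcases hσ k with hk | hk <;> rcases hσ l with hl | hl <;>
    rw [hj, hk, hl] <;> generalize σs / ω = s <;> (try simp only [zero_div]) <;>
    nlinarith [sq_nonneg s, sq_nonneg (s ^ 2)]
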